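/- Let F be a finite field of odd cardinality and let x ∈ F with x ≠ 0. Let h(x) = [[1,x],[0,1]] ∈ SL_2(F). Then there exist k ≤ 3 and elements z₁,…,z_k of SL_2(F), each of which is conjugate in SL_2(F) to h(x) or to h(x)⁻¹, such that the product t = z₁⋯z_k satisfies t² = −I₂. -/

import Mathlib

/-- The unipotent element `h(x) = [[1,x],[0,1]]` of `SL_2(F)`. -/
def hMat {F : Type*} [Field F] (x : F) : Matrix.SpecialLinearGroup (Fin 2) F :=
  ⟨!![1, x; 0, 1], by simp [Matrix.det_fin_two_of]⟩

/-- The lower unitriangular element `[[1,0],[y,1]]` of `SL_2(F)`. -/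
def lowerUnipotent {F : Type*} [Field F] (y : F) : Matrix.SpecialLinearGroup (Fin 2) F :=
  ⟨!![1, 0; y, 1], by simp [Matrix.det_fin_two_of]⟩

theorem isConj_hMat_lowerUnipotent {F : Type*} [Field F] {x : F} (hx : x ≠ 0) :
    IsConj (hMat x) (lowerUnipotent (-x⁻¹)) := by
  let s : Matrix.SpecialLinearGroup (Fin 2) F :=
    ⟨!![0, -x; x⁻¹, 0], by simp [Matrix.det_fin_two_of, hx]⟩
  refine isConj_iff.mpr ⟨s, mul_inv_eq_iff_eq_mul.mpr (Subtype.ext ?_)⟩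
  change !![0, -x; x⁻¹, 0] * !![1, x; 0, 1] = !![1, 0; -x⁻¹, 1] * !![0, -x; x⁻¹, 0]
  simp [hx]

theorem stmt_15 {F : Type*} [Field F] [Fintype F] (hodd : Odd (Fintype.card F))
    (x : F) (hx : x ≠ 0) :
    ∃ k ≤ 3, ∃ z : Fin k → Matrix.SpecialLinearGroup (Fin 2) F,
      (∀ i, IsConj (hMat x) (z i) ∨ IsConj (hMat x)⁻¹ (z i)) ∧
      (((List.ofFn z).prod ^ 2 : Matrix.SpecialLinearGroup (Fin 2) F) :
        Matrix (Fin 2) (Fin 2) F) = -1 := by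
  have hconj := isConj_hMat_lowerUnipotent hx
  refine ⟨3, le_rfl, ![hMat x, lowerUnipotent (-x⁻¹), lowerUnipotent (-x⁻¹)], ?_, ?_⟩
  · intro i
    left
    fin_cases i
    exacts [IsConj.refl _, hconj, hconj]
  · have hprod : ((hMat x * (lowerUnipotent (-x⁻¹) * lowerUnipotent (-x⁻¹)) :
        Matrix.SpecialLinearGroup (Fin 2) F) : Matrix (Fin 2) (Fin 2) F) =
        !![-1, x; -2 * x⁻¹, 1] := by
      change !![1, x; 0, 1] * (!![1, 0; -x⁻¹, 1] * !![1, 0; -x⁻¹, 1]) = _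
      ext i j
      fin_cases i <;> fin_cases j <;> simp <;> field_simp <;> ring
    simp only [List.ofFn_succ, List.ofFn_zero, List.prod_cons, List.prod_nil, mul_one,
      Matrix.cons_val_zero, Matrix.cons_val_succ, Matrix.SpecialLinearGroup.coe_pow, hprod]
    ext i j
    fin_cases i <;> fin_cases j <;> simp [pow_two] <;> field_simp <;> ring
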